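/- Let N be a finite index set with |N| nodes, n, m ≥ 1, H an m×n real matrix, and for each s ∈ N let x̂_s ∈ ℝⁿ, y_s ∈ ℝᵐ, and V_s an m×m positive semidefinite matrix. Let F_c be a symmetric positive semidefinite |N|n × |N|n matrix with n×n blocks F_{js} (j-th block row, s-th block column), and set F_s := Σ_{j∈N} F_{js} for each s ∈ N. Let 𝓗 be the |N|n × n vertical stack of |N| copies of the identity Iₙ and 𝓧 the vertical stack of the x̂_s. Assume M := Σ_{s∈N} (F_s + Hᵀ V_s H) is invertible. Then the objective J(x) = (𝓧 − 𝓗 x)ᵀ F_c (𝓧 − 𝓗 x) + Σ_{s∈N} (y_s − H x)ᵀ V_s (y_s − H x) attains its minimum over x ∈ ℝⁿ at x⋆ = M⁻¹ Σ_{s∈N} (F_s x̂_s + Hᵀ V_s y_s). -/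

import Mathlib

open Matrix

/-- First-order lower bound for a weighted least squares residual: the quadratic term dropped on
the left is nonnegative. -/
theorem Matrix.PosSemidef.sub_two_mul_le_residual {ι κ : Type*} [Fintype ι] [Fintype κ]
    {W : Matrix ι ι ℝ} (hW : W.PosSemidef) (A : Matrix ι κ ℝ) (c : ι → ℝ) (z x : κ → ℝ) :
    (c - A *ᵥ z) ⬝ᵥ W *ᵥ (c - A *ᵥ z) - 2 * ((x - z) ⬝ᵥ Aᵀ *ᵥ W *ᵥ (c - A *ᵥ z)) ≤
      (c - A *ᵥ x) ⬝ᵥ W *ᵥ (c - A *ᵥ x) := by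
  have hsplit : c - A *ᵥ x = c - A *ᵥ z - A *ᵥ (x - z) := by
    rw [mulVec_sub]
    abel
  rw [hsplit]
  generalize c - A *ᵥ z = r
  generalize x - z = d
  have hsymm : Wᵀ = W := by simpa [conjTranspose_eq_transpose_of_trivial] using hW.isHermitian.eq
  have hnonneg : 0 ≤ (A *ᵥ d) ⬝ᵥ W *ᵥ (A *ᵥ d) := by
    simpa using hW.dotProduct_mulVec_nonneg (A *ᵥ d)
  have hcross : (A *ᵥ d) ⬝ᵥ W *ᵥ r = d ⬝ᵥ Aᵀ *ᵥ W *ᵥ r := by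
    rw [dotProduct_mulVec d, vecMul_transpose]
  have hcross' : r ⬝ᵥ W *ᵥ (A *ᵥ d) = d ⬝ᵥ Aᵀ *ᵥ W *ᵥ r := by
    rw [← hcross, dotProduct_mulVec, ← mulVec_transpose, hsymm, dotProduct_comm]
  simp only [mulVec_sub, dotProduct_sub, sub_dotProduct, hcross, hcross']
  linarith

/-- Multiplying by the transposed stack of identity matrices sums the block rows. -/
theorem stackedOne_transpose_mulVec_mulVec {N κ : Type*} [Fintype N] [Fintype κ] [DecidableEq κ]
    (F : Matrix (N × κ) (N × κ) ℝ) (v : N × κ → ℝ) :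
    (Matrix.of fun (p : N × κ) (q : κ) => if p.2 = q then (1 : ℝ) else 0)ᵀ *ᵥ F *ᵥ v =
      ∑ s, (Matrix.of fun a b => ∑ j, F (j, a) (s, b)) *ᵥ fun b => v (s, b) := by
  ext a
  simp only [mulVec, dotProduct, transpose_apply, of_apply, Finset.sum_apply,
    Fintype.sum_prod_type, ite_mul, one_mul, zero_mul, Finset.sum_ite_eq', Finset.mem_univ,
    if_true, Finset.sum_mul]
  rw [Finset.sum_comm]
  exact Finset.sum_congr rfl fun s _ => Finset.sum_comm

/-- The stack of identity matrices repeats a vector in every block. -/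
theorem stackedOne_mulVec {N κ : Type*} [Fintype κ] [DecidableEq κ] (x : κ → ℝ) :
    (Matrix.of fun (p : N × κ) (q : κ) => if p.2 = q then (1 : ℝ) else 0) *ᵥ x =
      fun p => x p.2 := by
  ext p
  simp [mulVec, dotProduct]

/-- **Stacked weighted least squares reduces to a per-node summation form.**
With a joint positive semidefinite prior information matrix `F_c` over all nodes
(with `n×n` blocks `F_{js}`), per-node prior weights `F_s = Σ_j F_{js}`, stacked
identity `𝓗` and stacked priors `𝓧`, the objective
`J(x) = (𝓧 − 𝓗 x)ᵀ F_c (𝓧 − 𝓗 x) + Σ_s (y_s − H x)ᵀ V_s (y_s − H x)`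
attains its minimum at `x⋆ = M⁻¹ Σ_s (F_s x̂_s + Hᵀ V_s y_s)`, where
`M = Σ_s (F_s + Hᵀ V_s H)` is assumed invertible. -/
theorem stacked_wls_summation_form
    {N : Type*} [Fintype N] {n m : ℕ} (hn : 1 ≤ n) (hm : 1 ≤ m)
    (H : Matrix (Fin m) (Fin n) ℝ)
    (xhat : N → Fin n → ℝ) (y : N → Fin m → ℝ)
    (V : N → Matrix (Fin m) (Fin m) ℝ) (hV : ∀ s, (V s).PosSemidef)
    (Fc : Matrix (N × Fin n) (N × Fin n) ℝ) (hFc : Fc.PosSemidef) :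
    let Fs : N → Matrix (Fin n) (Fin n) ℝ :=
      fun s => Matrix.of fun a b => ∑ j, Fc (j, a) (s, b)
    let 𝓗 : Matrix (N × Fin n) (Fin n) ℝ :=
      Matrix.of fun p q => if p.2 = q then 1 else 0
    let 𝓧 : N × Fin n → ℝ := fun p => xhat p.1 p.2
    let M := ∑ s, (Fs s + Hᵀ * V s * H)
    let J : (Fin n → ℝ) → ℝ := fun x =>
      (𝓧 - 𝓗 *ᵥ x) ⬝ᵥ Fc *ᵥ (𝓧 - 𝓗 *ᵥ x)
        + ∑ s, (y s - H *ᵥ x) ⬝ᵥ (V s) *ᵥ (y s - H *ᵥ x)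
    IsUnit M →
      ∀ x : Fin n → ℝ,
        J (M⁻¹ *ᵥ ∑ s, (Fs s *ᵥ xhat s + (Hᵀ * V s) *ᵥ y s)) ≤ J x := by
  intro Fs 𝓗 𝓧 M J hM x
  set b := ∑ s, (Fs s *ᵥ xhat s + (Hᵀ * V s) *ᵥ y s) with hb
  set z := M⁻¹ *ᵥ b with hz
  have hnormal : M *ᵥ z = b := by
    rw [hz, mulVec_mulVec, mul_nonsing_inv M ((isUnit_iff_isUnit_det M).mp hM), one_mulVec]
  have hprior : 𝓗ᵀ *ᵥ Fc *ᵥ (𝓧 - 𝓗 *ᵥ z) = ∑ s, Fs s *ᵥ (xhat s - z) := by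
    rw [stackedOne_transpose_mulVec_mulVec, stackedOne_mulVec]
    rfl
  have hgrad : 𝓗ᵀ *ᵥ Fc *ᵥ (𝓧 - 𝓗 *ᵥ z) + ∑ s, Hᵀ *ᵥ V s *ᵥ (y s - H *ᵥ z) = 0 := by
    have hsum : M *ᵥ z = ∑ s, (Fs s *ᵥ z + (Hᵀ * V s * H) *ᵥ z) := by
      simp only [M, sum_mulVec, add_mulVec]
    rw [hprior, ← Finset.sum_add_distrib, ← sub_eq_zero.mpr hnormal.symm, hsum, hb,
      ← Finset.sum_sub_distrib]
    refine Finset.sum_congr rfl fun s _ => ?_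
    simp only [mulVec_sub, mulVec_mulVec, Matrix.mul_assoc]
    abel
  have hF := hFc.sub_two_mul_le_residual 𝓗 𝓧 z x
  have hVsum := Finset.sum_le_sum fun s (_ : s ∈ Finset.univ) =>
    (hV s).sub_two_mul_le_residual H (y s) z x
  have hzero := congrArg ((x - z) ⬝ᵥ ·) hgrad
  simp only [dotProduct_add, dotProduct_sum, dotProduct_zero] at hzero
  simp only [Finset.sum_sub_distrib, ← Finset.mul_sum] at hVsum
  simp only [J]
  linarith
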